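/- arXiv:0909.2561 — 4 statements merged into one kernel-verified Lean document; each statement's English description precedes it below -/
import Mathlib

section
/- Let A, B, A', B' be sets (in an arbitrary type). The unordered pairs {A, B} and {A', B'} are coherent if and only if for every a ∈ A, b ∈ B, a' ∈ A', b' ∈ B', the unordered pairs {a, b} and {a', b'} are distinct (i.e., it is not the case that a = a' and b = b', and it is not the case that a = b' and b = a'). -/
/-- Two unordered pairs of sets `{A, B}` and `{A', B'}` are *coherent* if one of the four
sets is disjoint from the union of the two sets in the other pair. -/
def PairsCoherent {α : Type*} (A B A' B' : Set α) : Prop :=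
  A ∩ (A' ∪ B') = ∅ ∨ B ∩ (A' ∪ B') = ∅ ∨ A' ∩ (A ∪ B) = ∅ ∨ B' ∩ (A ∪ B) = ∅

/-- The unordered pairs `{A, B}` and `{A', B'}` are coherent if and only if for all
`a ∈ A`, `b ∈ B`, `a' ∈ A'`, `b' ∈ B'` the unordered pairs `{a, b}` and `{a', b'}`
are distinct. -/
theorem coherent_iff_pairs_distinct {α : Type*} (A B A' B' : Set α) :
    PairsCoherent A B A' B' ↔
      ∀ a ∈ A, ∀ b ∈ B, ∀ a' ∈ A', ∀ b' ∈ B',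
        ¬((a = a' ∧ b = b') ∨ (a = b' ∧ b = a')) := by
  simp only [PairsCoherent, Set.eq_empty_iff_forall_notMem, Set.mem_inter_iff, Set.mem_union]
  constructor
  · rintro h a ha b hb a' ha' b' hb' (⟨rfl, rfl⟩ | ⟨rfl, rfl⟩) <;>
      rcases h with h | h | h | h <;> grind
  · intro h
    have hparallel : (∀ x ∈ A, x ∉ A') ∨ (∀ x ∈ B, x ∉ B') := by
      by_contra! hc
      obtain ⟨⟨x, hx, hx'⟩, y, hy, hy'⟩ := hc
      exact h x hx y hy x hx' y hy' (Or.inl ⟨rfl, rfl⟩)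
    have hcrossed : (∀ x ∈ A, x ∉ B') ∨ (∀ x ∈ B, x ∉ A') := by
      by_contra! hc
      obtain ⟨⟨x, hx, hx'⟩, y, hy, hy'⟩ := hc
      exact h x hx y hy y hy' x hx' (Or.inr ⟨rfl, rfl⟩)
    rcases hparallel with h₁ | h₁ <;> rcases hcrossed with h₂ | h₂
    · exact Or.inl (by grind)
    · exact Or.inr (Or.inr (Or.inl (by grind)))
    · exact Or.inr (Or.inr (Or.inr (by grind)))
    · exact Or.inr (Or.inl (by grind))
end

section
/- Let G be a simple graph and v a vertex of G. If all vertices in the neighborhood N_G(v) have the same set of neighbors (i.e., N_G(u) = N_G(u') for all u, u' ∈ N_G(v)), then v has a homogeneous neighborhood in G. -/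
/-- A vertex `v` has a *homogeneous neighborhood* in `G` if every permutation of the
neighborhood `N_G(v)` extends to an automorphism of `G` fixing `v`. -/
def HasHomogeneousNeighborhood {V : Type*} (G : SimpleGraph V) (v : V) : Prop :=
  ∀ π : Equiv.Perm (G.neighborSet v), ∃ φ : G ≃g G,
    φ v = v ∧ ∀ u : G.neighborSet v, φ (u : V) = ((π u : G.neighborSet v) : V)

/-- If all vertices in `N_G(v)` have the same set of neighbors, then `v` has a
homogeneous neighborhood in `G`. -/
theorem hasHomogeneousNeighborhood_of_same_neighborSet {V : Type*}
    (G : SimpleGraph V) (v : V)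
    (h : ∀ u ∈ G.neighborSet v, ∀ u' ∈ G.neighborSet v,
      G.neighborSet u = G.neighborSet u') :
    HasHomogeneousNeighborhood G v := by
  classical
  intro π
  have key (a b : V) : G.Adj (Equiv.Perm.ofSubtype π a) b ↔ G.Adj a b := by
    by_cases ha : a ∈ G.neighborSet v
    · have hπ : Equiv.Perm.ofSubtype π a = π ⟨a, ha⟩ :=
        Equiv.Perm.ofSubtype_apply_of_mem π ha
      rw [hπ]
      exact Set.ext_iff.mp (h _ (π ⟨a, ha⟩).2 a ha) b
    · rw [Equiv.Perm.ofSubtype_apply_of_not_mem π ha]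
  refine ⟨⟨Equiv.Perm.ofSubtype π, fun {a b} => ?_⟩, ?_, fun u => ?_⟩
  · rw [key, G.adj_comm, key, G.adj_comm]
  · exact Equiv.Perm.ofSubtype_apply_of_not_mem π (G.loopless.irrefl v)
  · exact Equiv.Perm.ofSubtype_apply_coe π u
end

section
/- Let a, b be positive integers with a < 3b, set r = 3 + a/b, and let k be an integer with k ≥ f(r), where f(r) = 240 + 512/(6−r)² + 224/(6−r) + 25/(16(r−3)²) + 40/(r−3). Define by division with remainder: b = b'·a + b_r with 0 ≤ b_r < a; b' = 4b'' + b'_r with 0 ≤ b'_r < 4; 4b = b̄·(3b−a) + b̄_r with 0 ≤ b̄_r < 3b−a; and k − b''(b''+5)/2 − 8b̄(4b̄+7) = k'(2b''+5) + k_r with k' ≥ 0 and 0 ≤ k_r < 2b''+5. Set n = b''+4, c = 2k' − 12b'' − 6k_r − 33, p = k − (b''(b''+23)/2 + 8b̄(4b̄+7) + 4k_r + 56), and q = 2b'' + k_r + 5. Then n ≥ 3, c ≥ 0, p ≥ 1, and q ≥ 1. -/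
/-- The lower-bound function `f` from the main theorem. -/
noncomputable def paperF (r : ℝ) : ℝ :=
  240 + 512 / (6 - r) ^ 2 + 224 / (6 - r) + 25 / (16 * (r - 3) ^ 2) + 40 / (r - 3)

/-- Substituting `u ≤ 4 / (6 - r)` and `v ≤ (1 / 4) / (r - 3)` bounds `paperF r` from below. -/
theorem le_paperF {r u v : ℝ} (hu : 0 ≤ u) (hv : 0 ≤ v) (hur : u ≤ 4 / (6 - r))
    (hvr : v ≤ 1 / 4 / (r - 3)) :
    240 + 32 * u ^ 2 + 56 * u + 25 * v ^ 2 + 160 * v ≤ paperF r := by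
  have hF : paperF r = 240 + 32 * (4 / (6 - r)) ^ 2 + 56 * (4 / (6 - r)) +
      25 * (1 / 4 / (r - 3)) ^ 2 + 160 * (1 / 4 / (r - 3)) := by
    unfold paperF
    generalize 6 - r = s, r - 3 = t
    ring
  rw [hF]
  gcongr

/-- The `t`-independent constraints of the main construction: for `r = 3 + a/b ∈ (3,6)`
and `k ≥ f(r)`, with the stated Euclidean divisions, the parameters satisfy
`n ≥ 3`, `c ≥ 0`, `p ≥ 1` and `q ≥ 1`. (The quantity `b''*(b''+5)` is even, so the
integer division by `2` is exact.) -/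
theorem main_construction_constraints_t_independent
    (a b : ℤ) (ha : 0 < a) (hb : 0 < b) (hab : a < 3 * b)
    (k : ℤ) (hk : paperF (3 + (a : ℝ) / (b : ℝ)) ≤ (k : ℝ))
    (b' br b'' b'r bbar bbarr k' kr : ℤ)
    (hdiv1 : b = b' * a + br) (hbr0 : 0 ≤ br) (hbr : br < a)
    (hdiv2 : b' = 4 * b'' + b'r) (hb'r0 : 0 ≤ b'r) (hb'r : b'r < 4)
    (hdiv3 : 4 * b = bbar * (3 * b - a) + bbarr) (hbbarr0 : 0 ≤ bbarr)
    (hbbarr : bbarr < 3 * b - a)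
    (hdiv4 : k - b'' * (b'' + 5) / 2 - 8 * bbar * (4 * bbar + 7) = k' * (2 * b'' + 5) + kr)
    (hk' : 0 ≤ k') (hkr0 : 0 ≤ kr) (hkr : kr < 2 * b'' + 5) :
    3 ≤ b'' + 4 ∧
    0 ≤ 2 * k' - 12 * b'' - 6 * kr - 33 ∧
    1 ≤ k - (b'' * (b'' + 23) / 2 + 8 * bbar * (4 * bbar + 7) + 4 * kr + 56) ∧
    1 ≤ 2 * b'' + kr + 5 := by
  have hb'0 : 0 ≤ b' := by
    by_contra! h
    nlinarith
  have hb''0 : 0 ≤ b'' := by omega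
  have hbbar0 : 0 ≤ bbar := by
    by_contra! h
    nlinarith
  have hkZ : 240 + 32 * bbar ^ 2 + 56 * bbar + 25 * b'' ^ 2 + 160 * b'' ≤ k := by
    have haR : (0 : ℝ) < a := by exact_mod_cast ha
    have hbR : (0 : ℝ) < b := by exact_mod_cast hb
    have habR : (0 : ℝ) < 3 * b - a := by exact_mod_cast sub_pos.2 hab
    have hu : (bbar : ℝ) ≤ 4 / (6 - (3 + (a : ℝ) / b)) := by
      have h : 4 / (6 - (3 + (a : ℝ) / b)) = 4 * b / (3 * b - a) := by
        have : 6 - (3 + (a : ℝ) / b) = (3 * b - a) / b := by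
          field_simp
          ring
        rw [this, div_div_eq_mul_div]
      rw [h, le_div_iff₀ habR]
      have : bbar * (3 * b - a) ≤ 4 * b := by linarith
      exact_mod_cast this
    have hv : (b'' : ℝ) ≤ 1 / 4 / (3 + (a : ℝ) / b - 3) := by
      have h : 1 / 4 / (3 + (a : ℝ) / b - 3) = b / (4 * a) := by
        rw [add_sub_cancel_left]
        field_simp
      rw [h, le_div_iff₀ (by positivity)]
      have : b'' * (4 * a) ≤ b := by nlinarith
      exact_mod_cast this
    have h := (le_paperF (by exact_mod_cast hbbar0) (by exact_mod_cast hb''0) hu hv).trans hk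
    exact_mod_cast h
  have hhalf : b'' * (b'' + 23) / 2 = b'' * (b'' + 5) / 2 + 9 * b'' := by
    rw [show b'' * (b'' + 23) = b'' * (b'' + 5) + 9 * b'' * 2 by ring]
    exact Int.add_mul_ediv_right _ _ two_ne_zero
  have hle : 2 * (b'' * (b'' + 5) / 2) ≤ b'' * (b'' + 5) := Int.mul_ediv_self_le two_ne_zero
  rw [hhalf]
  generalize b'' * (b'' + 5) / 2 = e at *
  refine ⟨by omega, ?_, by nlinarith, by omega⟩
  by_contra! h
  have hk'lt : 2 * k' ≤ 24 * b'' + 56 := by linarith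
  nlinarith [mul_le_mul_of_nonneg_right hk'lt (by omega : 0 ≤ 2 * b'' + 5)]
end

section
/- Let a, b be positive integers with a < 3b, set r = 3 + a/b, and let k be an integer with k ≥ f(r), where f(r) = 240 + 512/(6−r)² + 224/(6−r) + 25/(16(r−3)²) + 40/(r−3). Define by division with remainder: b = b'·a + b_r with 0 ≤ b_r < a; b' = 4b'' + b'_r with 0 ≤ b'_r < 4; 4b = b̄·(3b−a) + b̄_r with 0 ≤ b̄_r < 3b−a; and k − b''(b''+5)/2 − 8b̄(4b̄+7) = k'(2b''+5) + k_r with k' ≥ 0 and 0 ≤ k_r < 2b''+5. Set n = b''+4, w = b̄, c = 2k' − 12b'' − 6k_r − 33 and, for an integer t ≥ k, set m_t = 2t(27b − 9a − 4b̄_r) − 2k' + 3 and s_t = 2t((4b''+9)a − b). Then for every integer t ≥ k: m_t is odd with m_t = 2m'_t + 1 where m'_t ≥ 2·(n(n−1)/2) = n(n−1); c ≤ 2m_t(n−3); and s_t ≥ 4(32w² + 56w + 31). -/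
theorem le_paperF_s12 {a b x y : ℝ} (ha : 0 < a) (hb : 0 < b) (hab : a < 3 * b)
    (hx0 : 0 ≤ x) (hy0 : 0 ≤ y) (hx : x * (3 * b - a) ≤ 4 * b) (hy : 4 * y * a ≤ b) :
    240 + 32 * x ^ 2 + 56 * x + 25 * y ^ 2 + 160 * y ≤ paperF (3 + a / b) := by
  have hd : 0 < 3 * b - a := by linarith
  have hx' : x ≤ 4 * b / (3 * b - a) := (le_div_iff₀ hd).2 hx
  have hy' : 4 * y ≤ b / a := (le_div_iff₀ ha).2 hy
  have hf : paperF (3 + a / b) = 240 + 32 * (4 * b / (3 * b - a)) ^ 2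
      + 56 * (4 * b / (3 * b - a)) + 25 / 16 * (b / a) ^ 2 + 40 * (b / a) := by
    have h6 : 6 - (3 + a / b) = (3 * b - a) / b := by field_simp; ring
    have h3 : 3 + a / b - 3 = a / b := by ring
    have hd' := hd.ne'
    rw [paperF, h6, h3]
    generalize 3 * b - a = d at *
    field_simp
    ring
  have hx2 : x ^ 2 ≤ (4 * b / (3 * b - a)) ^ 2 := by gcongr
  have hy2 : (4 * y) ^ 2 ≤ (b / a) ^ 2 := by gcongr
  rw [hf]
  linarith

/-- The `t`-dependent constraints of the main construction: for `r = 3 + a/b ∈ (3,6)`,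
`k ≥ f(r)`, with the stated Euclidean divisions, and for every integer `t ≥ k`:
`m_t` is odd, `m_t = 2 m'_t + 1` with `m'_t ≥ 2·C(n,2) = n(n-1)`; `c ≤ 2 m_t (n-3)`;
and `s_t ≥ 4(32w² + 56w + 31)`. (The quantity `b''*(b''+5)` is even, so the integer
division by `2` is exact.) -/
theorem main_construction_constraints_t_dependent
    (a b : ℤ) (ha : 0 < a) (hb : 0 < b) (hab : a < 3 * b)
    (k : ℤ) (hk : paperF (3 + (a : ℝ) / (b : ℝ)) ≤ (k : ℝ))
    (b' br b'' b'r bbar bbarr k' kr : ℤ)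
    (hdiv1 : b = b' * a + br) (hbr0 : 0 ≤ br) (hbr : br < a)
    (hdiv2 : b' = 4 * b'' + b'r) (hb'r0 : 0 ≤ b'r) (hb'r : b'r < 4)
    (hdiv3 : 4 * b = bbar * (3 * b - a) + bbarr) (hbbarr0 : 0 ≤ bbarr)
    (hbbarr : bbarr < 3 * b - a)
    (hdiv4 : k - b'' * (b'' + 5) / 2 - 8 * bbar * (4 * bbar + 7) = k' * (2 * b'' + 5) + kr)
    (hk' : 0 ≤ k') (hkr0 : 0 ≤ kr) (hkr : kr < 2 * b'' + 5) :
    ∀ t : ℤ, k ≤ t →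
      let n : ℤ := b'' + 4
      let w : ℤ := bbar
      let c : ℤ := 2 * k' - 12 * b'' - 6 * kr - 33
      let m : ℤ := 2 * t * (27 * b - 9 * a - 4 * bbarr) - 2 * k' + 3
      let s : ℤ := 2 * t * ((4 * b'' + 9) * a - b)
      (∃ m' : ℤ, m = 2 * m' + 1 ∧ n * (n - 1) ≤ m') ∧
      c ≤ 2 * m * (n - 3) ∧
      4 * (32 * w ^ 2 + 56 * w + 31) ≤ s := by
  have hd : 0 < 3 * b - a := by linarith
  have hq : 0 ≤ bbar := by
    by_contra! h
    nlinarith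
  have hb' : 0 ≤ b' := by
    by_contra! h
    nlinarith
  have hb'' : 0 ≤ b'' := by omega
  have hba : 4 * b'' * a ≤ b := by nlinarith
  have hqb : bbar * (3 * b - a) ≤ 4 * b := by linarith
  have hk2 : 240 + 32 * bbar ^ 2 + 56 * bbar + 25 * b'' ^ 2 + 160 * b'' ≤ k := by
    have := (le_paperF_s12 (a := a) (b := b) (x := bbar) (y := b'') (by exact_mod_cast ha)
      (by exact_mod_cast hb) (by exact_mod_cast hab) (by exact_mod_cast hq)
      (by exact_mod_cast hb'') (by exact_mod_cast hqb) (by exact_mod_cast hba)).trans hk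
    exact_mod_cast this
  have hk'k : k' ≤ k := by
    have h1 : 0 ≤ b'' * (b'' + 5) / 2 := by positivity
    have h2 : 0 ≤ 8 * bbar * (4 * bbar + 7) := by positivity
    have h3 : 0 ≤ k' * (2 * b'' + 4) := by positivity
    linarith
  intro t ht n w c m s
  have hsq : 0 ≤ bbar ^ 2 := sq_nonneg _
  have hsq' : 0 ≤ b'' ^ 2 := sq_nonneg _
  have ht0 : 0 ≤ t := by linarith
  have hm : t * 9 ≤ t * (27 * b - 9 * a - 4 * bbarr) :=
    mul_le_mul_of_nonneg_left (by linarith) ht0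
  have hs : t * 5 ≤ t * ((4 * b'' + 9) * a - b) := by
    refine mul_le_mul_of_nonneg_left ?_ ht0
    have : b' * a ≤ (4 * b'' + 3) * a := mul_le_mul_of_nonneg_right (by linarith) ha.le
    linarith
  refine ⟨⟨t * (27 * b - 9 * a - 4 * bbarr) - k' + 1, by ring, ?_⟩, ?_, ?_⟩
  · change (b'' + 4) * (b'' + 4 - 1) ≤ _
    linarith
  · have hm0 : t ≤ m := by
      change t ≤ 2 * t * (27 * b - 9 * a - 4 * bbarr) - 2 * k' + 3
      linarith
    have hmb : 0 ≤ m * b'' := mul_nonneg (ht0.trans hm0) hb''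
    change 2 * k' - 12 * b'' - 6 * kr - 33 ≤ 2 * m * (b'' + 4 - 3)
    linarith
  · change 4 * (32 * bbar ^ 2 + 56 * bbar + 31) ≤ 2 * t * ((4 * b'' + 9) * a - b)
    linarith
end
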